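/- For n ≥ 4, the number of coatoms of L_n is ω(n-1) + 2, where ω(m) denotes the number of distinct prime divisors of m. -/

import Mathlib

open scoped Classical

/-- An arithmetic progression of integers: a finite set of the form
`{a, a+r, ..., a+(k-1)r}` with `a : ℤ`, `r ≥ 1` and `k ≥ 0` (so the empty set and all
singletons are arithmetic progressions). -/
def IsAP (s : Finset ℤ) : Prop :=
  ∃ (a r : ℤ) (k : ℕ), 1 ≤ r ∧ s = (Finset.range k).image (fun i => a + (i : ℤ) * r)

/-- The number `p_{nk}` of arithmetic progressions of cardinality `k` contained in `{1,…,n}`. -/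
noncomputable def numAP (n k : ℕ) : ℕ :=
  ((Finset.Icc (1:ℤ) (n:ℤ)).powerset.filter (fun s => IsAP s ∧ s.card = k)).card

/-- The Möbius function of the poset of arithmetic progressions ordered by inclusion,
defined by `μ(x,x) = 1` and `μ(x,y) = -∑_{x ≤ z < y} μ(x,z)`, where `z` ranges over
arithmetic progressions with `x ⊆ z ⊂ y`.  (For `x ⊆ y ⊆ {1,…,n}`, all arithmetic
progressions `z` with `x ⊆ z ⊂ y` automatically lie in `L_n`, so this is the Möbius
function of any interval `[x, y]` of the lattice `L_n`.) -/
noncomputable def apMu (x y : Finset ℤ) : ℤ :=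
  if x = y then 1
  else - ∑ z ∈ (y.powerset.filter (fun z => IsAP z ∧ x ⊆ z ∧ z ≠ y)).attach, apMu x z.1
termination_by y.card
decreasing_by
  rename_i z
  have hz := z.2
  rw [Finset.mem_filter, Finset.mem_powerset] at hz
  exact Finset.card_lt_card (lt_of_le_of_ne hz.1 hz.2.2.2)

/-- The join of `a` and `b` in the lattice of arithmetic progressions contained in `t`:
the intersection of all arithmetic progressions contained in `t` that contain `a ∪ b`,
i.e. the smallest such progression. -/
noncomputable def apJoin (t a b : Finset ℤ) : Finset ℤ :=
  t.filter (fun v => ∀ z : Finset ℤ, IsAP z → z ⊆ t → a ∪ b ⊆ z → v ∈ z)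

/-- The meet (intersection) of a finite family `S` of subsets of the top element `t`;
the meet of the empty family is `t` itself. -/
def apMeet (t : Finset ℤ) (S : Finset (Finset ℤ)) : Finset ℤ :=
  S.fold (· ⊓ ·) t id

/-- `x` is a coatom of the lattice `L_n` of arithmetic progressions contained in
`{1,…,n}`: an element distinct from the maximum `{1,…,n}` with no element strictly
between it and the maximum. -/
def IsCoatomIn (n : ℕ) (x : Finset ℤ) : Prop :=
  IsAP x ∧ x ⊆ Finset.Icc (1:ℤ) (n:ℤ) ∧ x ≠ Finset.Icc (1:ℤ) (n:ℤ) ∧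
    ∀ y : Finset ℤ, IsAP y → y ⊆ Finset.Icc (1:ℤ) (n:ℤ) → x ⊂ y → y = Finset.Icc (1:ℤ) (n:ℤ)

/-- `y` is covered by `top` in the poset of arithmetic progressions: `y < top` and there
is no arithmetic progression strictly between them. -/
def CoveredIn (top y : Finset ℤ) : Prop :=
  IsAP y ∧ y ⊂ top ∧ ¬ ∃ z : Finset ℤ, IsAP z ∧ y ⊂ z ∧ z ⊂ top

/-- `c` is a maximal chain in the lattice `L_n` of arithmetic progressions contained
in `{1,…,n}`: a chain (under inclusion) of elements of `L_n` to which no further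
element of `L_n` can be added. -/
def IsMaxChainIn (n : ℕ) (c : Finset (Finset ℤ)) : Prop :=
  (∀ s ∈ c, IsAP s ∧ s ⊆ Finset.Icc (1:ℤ) (n:ℤ)) ∧
  IsChain (· ⊆ ·) (↑c : Set (Finset ℤ)) ∧
  ∀ z : Finset ℤ, IsAP z → z ⊆ Finset.Icc (1:ℤ) (n:ℤ) →
    IsChain (· ⊆ ·) (insert z (↑c : Set (Finset ℤ))) → z ∈ c

/-- The number `b_{nk}` of chains of length `k` (i.e. totally ordered subsets with `k+1`
elements) in `L_n` that contain both `∅` and `{1,…,n}`. -/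
noncomputable def numChains (n k : ℕ) : ℕ :=
  (((Finset.Icc (1:ℤ) (n:ℤ)).powerset.filter IsAP).powerset.filter
    (fun c : Finset (Finset ℤ) => c.card = k + 1 ∧ ∅ ∈ c ∧ Finset.Icc (1:ℤ) (n:ℤ) ∈ c ∧
      IsChain (· ⊆ ·) (↑c : Set (Finset ℤ)))).card

/-- Membership form of `IsAP`, with the index ranging over the natural numbers. -/
theorem isAP_iff (s : Finset ℤ) :
    IsAP s ↔ ∃ (a r : ℤ) (k : ℕ), 1 ≤ r ∧
      s = (Finset.range k).image (fun i : ℕ => a + (i : ℤ) * r) := by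
  have key (a r : ℤ) (k : ℕ) :
      (Finset.range k).image (fun i => a + (i : ℤ) * r) =
        (Finset.range k).image (fun i : ℕ => a + (i : ℤ) * r) := by
    ext x
    simp [Finset.bind_def, Finset.pure_def]
  simp only [IsAP, key]

theorem isAP_Icc (a b : ℤ) : IsAP (Finset.Icc a b) := by
  rw [isAP_iff]
  refine ⟨a, 1, (b + 1 - a).toNat, le_rfl, ?_⟩
  ext x
  simp only [Finset.mem_Icc, Finset.mem_image, Finset.mem_range]
  constructor
  · rintro ⟨h1, h2⟩
    exact ⟨(x - a).toNat, by omega, by omega⟩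
  · rintro ⟨i, hi, rfl⟩
    omega

/-- The elements of `{1,…,n}` congruent to `1` modulo `r`. -/
noncomputable def residueOneAP (n : ℕ) (r : ℤ) : Finset ℤ :=
  (Finset.Icc (1:ℤ) (n:ℤ)).filter (fun x => r ∣ x - 1)

theorem mem_residueOneAP {n : ℕ} {r x : ℤ} :
    x ∈ residueOneAP n r ↔ (1 ≤ x ∧ x ≤ n) ∧ r ∣ x - 1 := by
  simp [residueOneAP]

theorem residueOneAP_subset (n : ℕ) (r : ℤ) :
    residueOneAP n r ⊆ Finset.Icc (1:ℤ) (n:ℤ) :=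
  Finset.filter_subset _ _

theorem residueOneAP_one (n : ℕ) : residueOneAP n 1 = Finset.Icc (1:ℤ) (n:ℤ) := by
  ext x
  simp [mem_residueOneAP]

theorem residueOneAP_subset_of_dvd (n : ℕ) {r s : ℤ} (h : s ∣ r) :
    residueOneAP n r ⊆ residueOneAP n s := by
  intro x hx
  rw [mem_residueOneAP] at hx ⊢
  exact ⟨hx.1, h.trans hx.2⟩

theorem residueOneAP_ne_Icc {n : ℕ} (hn : 2 ≤ n) {r : ℤ} (hr : 2 ≤ r) :
    residueOneAP n r ≠ Finset.Icc (1:ℤ) (n:ℤ) := by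
  intro h
  have h2 : (2:ℤ) ∈ residueOneAP n r := by
    rw [h, Finset.mem_Icc]
    omega
  have := Int.le_of_dvd (by norm_num) (mem_residueOneAP.1 h2).2
  omega

theorem isAP_residueOneAP {n : ℕ} (hn : 1 ≤ n) {r : ℤ} (hr : 1 ≤ r) :
    IsAP (residueOneAP n r) := by
  rw [isAP_iff]
  refine ⟨1, r, (((n:ℤ) - 1) / r + 1).toNat, hr, ?_⟩
  have hq : 0 ≤ ((n:ℤ) - 1) / r := Int.ediv_nonneg (by omega) (by omega)
  ext x
  simp only [mem_residueOneAP, Finset.mem_image, Finset.mem_range]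
  constructor
  · rintro ⟨⟨h1, h2⟩, m, hm⟩
    have hm0 : 0 ≤ m := by
      by_contra! h
      nlinarith
    have hmq : m ≤ ((n:ℤ) - 1) / r := by
      rw [Int.le_ediv_iff_mul_le (by omega)]
      nlinarith
    refine ⟨m.toNat, by omega, ?_⟩
    rw [Int.toNat_of_nonneg hm0]
    linarith
  · rintro ⟨i, hi, rfl⟩
    have hi' : (i:ℤ) ≤ ((n:ℤ) - 1) / r := by omega
    rw [Int.le_ediv_iff_mul_le (by omega)] at hi'
    have : 0 ≤ (i:ℤ) * r := by positivity
    exact ⟨⟨by omega, by omega⟩, i, by ring⟩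

/-- An arithmetic progression in `{1,…,n}` containing both endpoints is determined by its
common difference, which divides `n - 1`. -/
theorem IsAP.exists_eq_residueOneAP {n : ℕ} {y : Finset ℤ} (hy : IsAP y)
    (hsub : y ⊆ Finset.Icc (1:ℤ) (n:ℤ)) (h1 : (1:ℤ) ∈ y) (h2 : (n:ℤ) ∈ y) :
    ∃ r : ℕ, 1 ≤ r ∧ r ∣ n - 1 ∧ y = residueOneAP n r := by
  obtain ⟨a, r, k, hr, rfl⟩ := (isAP_iff y).1 hy
  have hn := Finset.mem_Icc.1 (hsub h1)
  obtain ⟨i, hi, hi1⟩ := Finset.mem_image.1 h1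
  obtain ⟨j, hj, hjn⟩ := Finset.mem_image.1 h2
  rw [Finset.mem_range] at hi hj
  have ha : a ∈ (Finset.range k).image (fun i : ℕ => a + (i : ℤ) * r) :=
    Finset.mem_image.2 ⟨0, by simp; omega, by simp⟩
  have ha1 := (Finset.mem_Icc.1 (hsub ha)).1
  have hir : 0 ≤ (i:ℤ) * r := by positivity
  obtain rfl : a = 1 := by omega
  lift r to ℕ using by omega
  refine ⟨r, by omega, ?_, ?_⟩
  · refine ⟨j, ?_⟩
    zify [show 1 ≤ n by omega]
    linarith
  · ext x
    rw [mem_residueOneAP]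
    constructor
    · intro hx
      refine ⟨Finset.mem_Icc.1 (hsub hx), ?_⟩
      obtain ⟨m, -, rfl⟩ := Finset.mem_image.1 hx
      exact ⟨m, by ring⟩
    · rintro ⟨⟨hx1, hx2⟩, m, hm⟩
      have hm0 : 0 ≤ m := by
        by_contra! h
        nlinarith
      have hmj : m ≤ j := by
        by_contra! h
        nlinarith
      refine Finset.mem_image.2 ⟨m.toNat, by rw [Finset.mem_range]; omega, ?_⟩
      rw [Int.toNat_of_nonneg hm0]
      linarith

theorem IsCoatomIn.eq_of_subset {n : ℕ} {x y : Finset ℤ} (hx : IsCoatomIn n x) (hy : IsAP y)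
    (hyn : y ⊆ Finset.Icc (1:ℤ) (n:ℤ)) (hne : y ≠ Finset.Icc (1:ℤ) (n:ℤ)) (hxy : x ⊆ y) :
    x = y := by
  by_contra h
  exact hne (hx.2.2.2 y hy hyn (hxy.ssubset_of_ne h))

theorem isCoatomIn_Icc_two {n : ℕ} (hn : 1 ≤ n) : IsCoatomIn n (Finset.Icc (2:ℤ) (n:ℤ)) := by
  refine ⟨isAP_Icc _ _, Finset.Icc_subset_Icc_left (by norm_num), ?_, ?_⟩
  · intro h
    have : (1:ℤ) ∈ Finset.Icc (2:ℤ) (n:ℤ) := by rw [h, Finset.mem_Icc]; omega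
    simp at this
  · intro y _ hyn hlt
    obtain ⟨z, hz, hz'⟩ := Finset.exists_of_ssubset hlt
    refine hyn.antisymm fun x hx => ?_
    have hzn := Finset.mem_Icc.1 (hyn hz)
    rw [Finset.mem_Icc] at hz' hx
    by_cases hxz : x = z
    · rwa [hxz]
    · exact hlt.1 (by rw [Finset.mem_Icc]; omega)

theorem isCoatomIn_Icc_sub_one {n : ℕ} (hn : 1 ≤ n) :
    IsCoatomIn n (Finset.Icc (1:ℤ) ((n:ℤ) - 1)) := by
  refine ⟨isAP_Icc _ _, Finset.Icc_subset_Icc_right (by omega), ?_, ?_⟩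
  · intro h
    have : (n:ℤ) ∈ Finset.Icc (1:ℤ) ((n:ℤ) - 1) := by rw [h, Finset.mem_Icc]; omega
    simp at this
  · intro y _ hyn hlt
    obtain ⟨z, hz, hz'⟩ := Finset.exists_of_ssubset hlt
    refine hyn.antisymm fun x hx => ?_
    have hzn := Finset.mem_Icc.1 (hyn hz)
    rw [Finset.mem_Icc] at hz' hx
    by_cases hxz : x = z
    · rwa [hxz]
    · exact hlt.1 (by rw [Finset.mem_Icc]; omega)

theorem one_mem_residueOneAP {n : ℕ} (hn : 1 ≤ n) (r : ℤ) : (1:ℤ) ∈ residueOneAP n r := by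
  rw [mem_residueOneAP]
  exact ⟨by omega, by simp⟩

theorem last_mem_residueOneAP {n r : ℕ} (hn : 1 ≤ n) (hr : r ∣ n - 1) :
    (n:ℤ) ∈ residueOneAP n r := by
  rw [mem_residueOneAP]
  refine ⟨by omega, ?_⟩
  have := Int.natCast_dvd_natCast.2 hr
  rwa [Nat.cast_sub hn, Nat.cast_one] at this

/-- Inclusion of the progressions reverses divisibility of their common differences. -/
theorem dvd_of_residueOneAP_subset {n p q : ℕ} (hn : 2 ≤ n) (hp : p ∣ n - 1)
    (h : residueOneAP n p ⊆ residueOneAP n q) : q ∣ p := by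
  have hle := Nat.le_of_dvd (by omega) hp
  have hmem : (1 + p : ℤ) ∈ residueOneAP n p := by
    rw [mem_residueOneAP]
    exact ⟨by omega, by simp⟩
  have := (mem_residueOneAP.1 (h hmem)).2
  rw [add_sub_cancel_left] at this
  exact_mod_cast this

theorem isCoatomIn_residueOneAP {n p : ℕ} (hn : 2 ≤ n) (hp : p.Prime) (hpn : p ∣ n - 1) :
    IsCoatomIn n (residueOneAP n p) := by
  have hp2 := hp.two_le
  refine ⟨isAP_residueOneAP (by omega) (by omega), residueOneAP_subset _ _,
    residueOneAP_ne_Icc hn (by omega), ?_⟩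
  intro y hy hyn hlt
  obtain ⟨r, -, -, rfl⟩ := hy.exists_eq_residueOneAP hyn
    (hlt.1 (one_mem_residueOneAP (by omega) _)) (hlt.1 (last_mem_residueOneAP (by omega) hpn))
  rcases (Nat.dvd_prime hp).1 (dvd_of_residueOneAP_subset hn hpn hlt.1) with rfl | rfl
  · exact_mod_cast residueOneAP_one n
  · exact absurd hlt (ssubset_irrefl _)

theorem isCoatomIn_iff {n : ℕ} (hn : 2 ≤ n) (x : Finset ℤ) :
    IsCoatomIn n x ↔ x = Finset.Icc (1:ℤ) ((n:ℤ) - 1) ∨ x = Finset.Icc (2:ℤ) (n:ℤ) ∨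
      ∃ p ∈ (n - 1).primeFactors, residueOneAP n p = x := by
  constructor
  · intro hx
    have hxn := hx.2.1
    by_cases hlast : (n:ℤ) ∈ x
    · by_cases hone : (1:ℤ) ∈ x
      · obtain ⟨r, hr, hrn, rfl⟩ := hx.1.exists_eq_residueOneAP hxn hone hlast
        have hr1 : r ≠ 1 := by
          rintro rfl
          exact hx.2.2.1 (by exact_mod_cast residueOneAP_one n)
        have hp := Nat.minFac_prime hr1
        have hp2 := hp.two_le
        refine .inr (.inr ⟨r.minFac, Nat.mem_primeFactors.2
          ⟨hp, (Nat.minFac_dvd r).trans hrn, by omega⟩, ?_⟩)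
        exact (hx.eq_of_subset (isAP_residueOneAP (by omega) (by omega))
          (residueOneAP_subset _ _) (residueOneAP_ne_Icc hn (by omega))
          (residueOneAP_subset_of_dvd n (Int.natCast_dvd_natCast.2 (Nat.minFac_dvd r)))).symm
      · have hc := isCoatomIn_Icc_two (n := n) (by omega)
        refine .inr (.inl (hx.eq_of_subset hc.1 hc.2.1 hc.2.2.1 fun z hz => ?_))
        have hzn := Finset.mem_Icc.1 (hxn hz)
        have : z ≠ 1 := fun h => hone (h ▸ hz)
        rw [Finset.mem_Icc]
        omega
    · have hc := isCoatomIn_Icc_sub_one (n := n) (by omega)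
      refine .inl (hx.eq_of_subset hc.1 hc.2.1 hc.2.2.1 fun z hz => ?_)
      have hzn := Finset.mem_Icc.1 (hxn hz)
      have : z ≠ n := fun h => hlast (h ▸ hz)
      rw [Finset.mem_Icc]
      omega
  · rintro (rfl | rfl | ⟨p, hp, rfl⟩)
    · exact isCoatomIn_Icc_sub_one (by omega)
    · exact isCoatomIn_Icc_two (by omega)
    · exact isCoatomIn_residueOneAP hn (Nat.prime_of_mem_primeFactors hp)
        (Nat.dvd_of_mem_primeFactors hp)

/-- For `n ≥ 4`, the number of coatoms of `L_n` is `ω(n-1) + 2`, where `ω(m)` is the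
number of distinct prime divisors of `m`. -/
theorem card_coatoms_Ln (n : ℕ) (hn : 4 ≤ n) :
    ((Finset.Icc (1:ℤ) (n:ℤ)).powerset.filter (IsCoatomIn n)).card
      = (n - 1).primeFactors.card + 2 := by
  have heq : (Finset.Icc (1:ℤ) (n:ℤ)).powerset.filter (IsCoatomIn n) =
      insert (Finset.Icc (1:ℤ) ((n:ℤ) - 1)) (insert (Finset.Icc (2:ℤ) (n:ℤ))
        ((n - 1).primeFactors.image fun p : ℕ => residueOneAP n p)) := by
    ext x
    simp only [Finset.mem_filter, Finset.mem_powerset, Finset.mem_insert, Finset.mem_image,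
      ← isCoatomIn_iff (show 2 ≤ n by omega) x]
    exact ⟨fun h => h.2, fun h => ⟨h.2.1, h⟩⟩
  rw [heq, Finset.card_insert_of_notMem, Finset.card_insert_of_notMem,
    Finset.card_image_of_injOn]
  · intro p hp q hq hpq
    have hp := Nat.dvd_of_mem_primeFactors hp
    have hq := Nat.dvd_of_mem_primeFactors hq
    simp only at hpq
    exact Nat.dvd_antisymm (dvd_of_residueOneAP_subset (by omega) hq hpq.ge)
      (dvd_of_residueOneAP_subset (by omega) hp hpq.le)
  · rw [Finset.mem_image]
    rintro ⟨p, -, h⟩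
    have := one_mem_residueOneAP (n := n) (by omega) p
    rw [h] at this
    simp at this
  · rw [Finset.mem_insert, Finset.mem_image]
    rintro (h | ⟨p, hp, h⟩)
    · have : (1:ℤ) ∈ Finset.Icc (1:ℤ) ((n:ℤ) - 1) := by rw [Finset.mem_Icc]; omega
      rw [h] at this
      simp at this
    · have := last_mem_residueOneAP (n := n) (by omega) (Nat.dvd_of_mem_primeFactors hp)
      rw [h] at this
      simp at this
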